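/- Let μ be a Borel probability measure of full support on the compact metric space M, and let f : Ω → ℝ be continuous and satisfy the weak Walters condition. Then there exist a real number λ_f > 0, a strictly positive continuous function h_f : Ω → ℝ, and a Borel probability measure ν_f on Ω such that: (i) L_f h_f = λ_f h_f and ∫_Ω L_f φ dν_f = λ_f ∫_Ω φ dν_f for all continuous φ; (ii) for every continuous φ : Ω → ℝ, ‖ λ_f^{−n} L_f^n φ − h_f · ∫_Ω φ dν_f ‖_0 → 0 as n → ∞; moreover, ν_f is the unique Borel probability measure satisfying ∫_Ω L_f φ dν_f = λ_f ∫_Ω φ dν_f for all continuous φ. -/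

import Mathlib

open MeasureTheory Filter

noncomputable section

namespace Paper

variable {M : Type*} [MetricSpace M]

/-- Prepend one symbol: `ax = (a, x₁, x₂, …)`. -/
def cons (a : M) (x : ℕ → M) : ℕ → M
  | 0 => a
  | n + 1 => x n

/-- Prepend a finite word `a ∈ Mⁿ`. -/
def consW {n : ℕ} (a : Fin n → M) (x : ℕ → M) : ℕ → M :=
  fun k => if h : k < n then a ⟨k, h⟩ else x (k - n)

/-- The left shift `σ`. -/
def shift (x : ℕ → M) : ℕ → M := fun n => x (n + 1)

/-- Birkhoff sum `Sₙ f = f + f∘σ + … + f∘σ^{n-1}`. -/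
def birk (f : (ℕ → M) → ℝ) (n : ℕ) (x : ℕ → M) : ℝ :=
  ∑ i ∈ Finset.range n, f (shift^[i] x)

/-- The metric `d_Ω(x,y) = Σ_{n≥1} 2^{-n} d(xₙ,yₙ)`. -/
def dOmega (x y : ℕ → M) : ℝ :=
  ∑' n : ℕ, (1 / 2 : ℝ) ^ (n + 1) * dist (x n) (y n)

/-- `dₙ(x,y) = max_{0 ≤ k < n} d_Ω(σᵏx, σᵏy)`. -/
def dN (n : ℕ) (x y : ℕ → M) : ℝ :=
  ⨆ k : Fin n, dOmega (shift^[(k : ℕ)] x) (shift^[(k : ℕ)] y)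

/-- The (strong) Walters condition. -/
def Walters (f : (ℕ → M) → ℝ) : Prop :=
  ∀ ε : ℝ, 0 < ε → ∃ η : ℝ, 0 < η ∧ ∀ n : ℕ, 1 ≤ n → ∀ x y : ℕ → M,
    dN n x y ≤ η → |birk f n x - birk f n y| ≤ ε

/-- `C_f(x,y) = sup_{n ≥ 1} sup_{a ∈ Mⁿ} (Sₙf(ax) − Sₙf(ay))`, a value in `(−∞,+∞]`. -/
def Cf (f : (ℕ → M) → ℝ) (x y : ℕ → M) : EReal :=
  ⨆ n : ℕ, ⨆ a : Fin (n + 1) → M,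
    ((birk f (n + 1) (consW a x) - birk f (n + 1) (consW a y) : ℝ) : EReal)

/-- The weak Walters condition. -/
def WeakWalters (f : (ℕ → M) → ℝ) : Prop :=
  ∀ ε : ℝ, 0 < ε → ∃ δ : ℝ, 0 < δ ∧ ∀ x y : ℕ → M,
    dOmega x y ≤ δ → Cf f x y ≤ (ε : EReal)

variable [MeasurableSpace M]

/-- The Ruelle operator `L_f φ(x) = ∫_M e^{f(ax)} φ(ax) dμ(a)`. -/
def ruelle (μ : Measure M) (f : (ℕ → M) → ℝ) (φ : (ℕ → M) → ℝ) : (ℕ → M) → ℝ :=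
  fun x => ∫ a, Real.exp (f (cons a x)) * φ (cons a x) ∂μ

/-- The Ruelle operator with weight `g`: `Lφ(x) = ∫_M g(ax) φ(ax) dμ(a)`. -/
def ruelleG (μ : Measure M) (g : (ℕ → M) → ℝ) (φ : (ℕ → M) → ℝ) : (ℕ → M) → ℝ :=
  fun x => ∫ a, g (cons a x) * φ (cons a x) ∂μ

section Abstract

open Topology

/-- An almost additive real sequence stays within bounded distance of a linear one. -/
theorem exists_forall_abs_sub_le_of_almost_additive {u : ℕ → ℝ} {d : ℝ}
    (hu : ∀ m n, |u (m + n) - u m - u n| ≤ d) : ∃ l : ℝ, ∀ n, |u n - n * l| ≤ d := by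
  have hd : 0 ≤ d := (abs_nonneg _).trans (hu 0 0)
  have hsub : Subadditive fun n => u n + d := fun m n => by
    linarith [(abs_le.1 (hu m n)).2]
  have hsub' : Subadditive fun n => d - u n := fun m n => by
    linarith [(abs_le.1 (hu m n)).1]
  have hlow : ∀ n : ℕ, n * (u 1 - d) - d ≤ u n := fun n => by
    have := hsub'.apply_mul_add_le n 1 0
    have h0 := (abs_le.1 (hu 0 0)).2
    simp only [mul_one, add_zero] at this h0
    linarith
  have hupp : ∀ n : ℕ, u n ≤ n * (u 1 + d) + d := fun n => by
    have := hsub.apply_mul_add_le n 1 0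
    have h0 := (abs_le.1 (hu 0 0)).1
    simp only [mul_one, add_zero] at this h0
    linarith
  have hbdd : BddBelow (Set.range fun n : ℕ => (u n + d) / n) := by
    refine ⟨-|u 1 - d|, ?_⟩
    rintro _ ⟨n, rfl⟩
    rcases Nat.eq_zero_or_pos n with rfl | hn
    · simp
    · have hn' : (0 : ℝ) < n := by exact_mod_cast hn
      have := hlow n
      rw [le_div_iff₀ hn']
      nlinarith [neg_abs_le (u 1 - d)]
  have hbdd' : BddBelow (Set.range fun n : ℕ => (d - u n) / n) := by
    refine ⟨-|u 1 + d|, ?_⟩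
    rintro _ ⟨n, rfl⟩
    rcases Nat.eq_zero_or_pos n with rfl | hn
    · simp
    · have hn' : (0 : ℝ) < n := by exact_mod_cast hn
      have := hupp n
      rw [le_div_iff₀ hn']
      nlinarith [le_abs_self (u 1 + d)]
  have hlim : hsub'.lim = -hsub.lim := by
    have h1 := hsub.tendsto_lim hbdd
    have h2 := hsub'.tendsto_lim hbdd'
    have h3 : Tendsto (fun n : ℕ => 2 * d / (n : ℝ)) atTop (𝓝 0) :=
      tendsto_const_nhds.div_atTop tendsto_natCast_atTop_atTop
    have h4 := tendsto_nhds_unique h3 ((h1.add h2).congr fun n => by ring)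
    linarith
  refine ⟨hsub.lim, fun n => ?_⟩
  rcases Nat.eq_zero_or_pos n with rfl | hn
  · have h0 := hu 0 0
    rw [abs_le] at h0 ⊢
    simp only [add_zero, Nat.cast_zero, zero_mul] at h0 ⊢
    constructor <;> linarith
  · have hn' : (0 : ℝ) < n := by exact_mod_cast hn
    have h1 := hsub.lim_le_div hbdd hn.ne'
    have h2 := hsub'.lim_le_div hbdd' hn.ne'
    rw [le_div_iff₀ hn'] at h1 h2
    rw [hlim] at h2
    rw [abs_le]
    constructor <;> linarith

/-- An almost multiplicative positive sequence is comparable to a geometric one. -/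
theorem exists_pow_comparable_of_almost_multiplicative {a : ℕ → ℝ} {D : ℝ} (ha : ∀ n, 0 < a n)
    (hD : 0 < D) (hle : ∀ m n, a (m + n) ≤ D * (a m * a n))
    (hge : ∀ m n, a m * a n ≤ D * a (m + n)) :
    ∃ l : ℝ, 0 < l ∧ ∀ n, a n ≤ D * l ^ n ∧ l ^ n ≤ D * a n := by
  obtain ⟨l, hl⟩ := exists_forall_abs_sub_le_of_almost_additive
    (u := fun n => Real.log (a n)) (d := Real.log D) fun m n => by
      have h1 := Real.log_le_log (ha _) (hle m n)
      have h2 := Real.log_le_log (mul_pos (ha m) (ha n)) (hge m n)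
      rw [Real.log_mul hD.ne' (mul_pos (ha m) (ha n)).ne',
        Real.log_mul (ha m).ne' (ha n).ne'] at h1
      rw [Real.log_mul hD.ne' (ha _).ne', Real.log_mul (ha m).ne' (ha n).ne'] at h2
      rw [abs_le]
      constructor <;> linarith
  refine ⟨Real.exp l, Real.exp_pos l, fun n => ?_⟩
  have h := abs_le.1 (hl n)
  have e1 : a n = Real.exp (Real.log (a n)) := (Real.exp_log (ha n)).symm
  have e2 : D = Real.exp (Real.log D) := (Real.exp_log hD).symm
  rw [← Real.exp_nat_mul, e1, e2, ← Real.exp_add, ← Real.exp_add, Real.exp_le_exp,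
    Real.exp_le_exp]
  constructor <;> linarith

/-- A family of functions oscillating locally, in ratio, by factors close to `1`. -/
def RatioEquicontinuous {X ι : Type*} [TopologicalSpace X] (F : ι → X → ℝ) : Prop :=
  ∀ r : ℝ, 1 < r → ∀ x, ∀ᶠ y in 𝓝 x, ∀ i, F i y ≤ r * F i x ∧ F i x ≤ r * F i y

theorem RatioEquicontinuous.equicontinuous {X ι : Type*} [TopologicalSpace X] {F : ι → X → ℝ}
    (hF : RatioEquicontinuous F) {B : ℝ} (hB : ∀ i x, F i x ≤ B) : Equicontinuous F := by
  intro x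
  rw [Metric.equicontinuousAt_iff_right]
  intro ε hε
  set b := max B 1
  have hb : 0 < b := lt_max_of_lt_right one_pos
  have h4 : 0 < ε / (2 * b) := by positivity
  have hr : 1 < 1 + ε / (2 * b) := by linarith
  filter_upwards [hF _ hr x] with y hy i
  have h1 := (hB i x).trans (le_max_left B 1)
  have h2 := (hB i y).trans (le_max_left B 1)
  have h3 : ε / (2 * b) * b = ε / 2 := by field_simp
  have h5 := mul_le_mul_of_nonneg_left h1 h4.le
  have h6 := mul_le_mul_of_nonneg_left h2 h4.le
  rw [Real.dist_eq, abs_lt]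
  constructor <;> nlinarith [hy i]

/-- Sequential form of the Arzelà–Ascoli theorem. -/
theorem exists_subseq_tendsto_of_equicontinuous {X : Type*} [TopologicalSpace X] [CompactSpace X]
    (F : ℕ → C(X, ℝ)) {B : ℝ} (hB : ∀ n x, |F n x| ≤ B)
    (hF : Equicontinuous fun n => (F n : X → ℝ)) :
    ∃ (G : C(X, ℝ)) (θ : ℕ → ℕ), StrictMono θ ∧ Tendsto (F ∘ θ) atTop (𝓝 G) := by
  set e := ContinuousMap.isometryEquivBoundedOfCompact X ℝ
  have hK : IsCompact (closure (Set.range fun n => e (F n))) := by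
    refine BoundedContinuousFunction.arzela_ascoli (Metric.closedBall 0 B)
      (isCompact_closedBall _ _) _ ?_ ?_
    · rintro _ x ⟨n, rfl⟩
      exact mem_closedBall_zero_iff.2 (hB n x)
    · intro x U hU
      filter_upwards [hF x U hU] with y hy
      rintro ⟨_, n, rfl⟩
      exact hy n
  obtain ⟨G, -, θ, hθ, h⟩ := hK.tendsto_subseq fun n => subset_closure ⟨n, rfl⟩
  refine ⟨e.symm G, θ, hθ, ?_⟩
  have := (e.symm.continuous.tendsto G).comp h
  refine this.congr fun n => ?_
  simp

variable {X : Type*} [TopologicalSpace X] [CompactSpace X]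

theorem iterate_le_of_positive {T : C(X, ℝ) →L[ℝ] C(X, ℝ)} (hpos : ∀ u, 0 ≤ u → 0 ≤ T u) (n : ℕ)
    {u v : C(X, ℝ)} (h : u ≤ v) : (T ^ n) u ≤ (T ^ n) v := by
  induction n with
  | zero => simpa using h
  | succ n ih =>
    rw [pow_succ', mul_apply_eq_comp, mul_apply_eq_comp, ← sub_nonneg,
      ← map_sub]
    exact hpos _ (sub_nonneg.2 ih)

/-- A power-bounded positive operator with bounded, ratio equicontinuous orbit of `1` has a
strictly positive fixed function. -/
theorem exists_pos_fixed {T : C(X, ℝ) →L[ℝ] C(X, ℝ)} {B : ℝ} (hB : 0 < B)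
    (hle : ∀ n x, (T ^ n) 1 x ≤ B) (hge : ∀ n x, 1 ≤ B * (T ^ n) 1 x)
    (heq : RatioEquicontinuous fun n => ((T ^ n) 1 : X → ℝ)) :
    ∃ h : C(X, ℝ), (∀ x, 0 < h x) ∧ T h = h := by
  set S : ℕ → C(X, ℝ) := fun N => ((N : ℝ) + 1)⁻¹ • ∑ n ∈ Finset.range (N + 1), (T ^ n) 1 with hS
  have hSx : ∀ N x, S N x = ((N : ℝ) + 1)⁻¹ * ∑ n ∈ Finset.range (N + 1), (T ^ n) 1 x :=
    fun N x => by simp [hS]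
  have hnn : ∀ n x, 0 ≤ (T ^ n) 1 x := fun n x => by
    by_contra hneg
    nlinarith [hge n x]
  have hSle : ∀ N x, S N x ≤ B := fun N x => by
    rw [hSx, inv_mul_le_iff₀ (by positivity)]
    calc _ ≤ ∑ n ∈ Finset.range (N + 1), B := Finset.sum_le_sum fun n _ => hle n x
      _ = _ := by simp
  have hSge : ∀ N x, B⁻¹ ≤ S N x := fun N x => by
    rw [hSx, le_inv_mul_iff₀ (by positivity)]
    calc _ = ∑ n ∈ Finset.range (N + 1), B⁻¹ := by simp
      _ ≤ _ := Finset.sum_le_sum fun n _ => (inv_le_iff_one_le_mul₀' hB).2 (hge n x)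
  have hSeq : RatioEquicontinuous fun N => (S N : X → ℝ) := by
    intro r hr x
    filter_upwards [heq r hr x] with y hy N
    simp only [hSx]
    constructor
    · rw [mul_left_comm, Finset.mul_sum _ _ r]
      gcongr with n _
      exact (hy n).1
    · rw [mul_left_comm, Finset.mul_sum _ _ r]
      gcongr with n _
      exact (hy n).2
  obtain ⟨h, θ, hθ, hlim⟩ := exists_subseq_tendsto_of_equicontinuous S (B := B)
    (fun N x => abs_le.2 ⟨by linarith [hSge N x, inv_pos.2 hB], hSle N x⟩)
    (hSeq.equicontinuous hSle)
  refine ⟨h, fun x => ?_, ?_⟩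
  · refine (inv_pos.2 hB).trans_le (ge_of_tendsto
      (((continuous_eval_const x).tendsto h).comp hlim)
      (Eventually.of_forall fun j => hSge _ x))
  · have h1 : Tendsto (fun N => T (S N) - S N) atTop (𝓝 0) := by
      rw [tendsto_zero_iff_norm_tendsto_zero]
      refine squeeze_zero (fun _ => norm_nonneg _) (g := fun N : ℕ => ((N : ℝ) + 1)⁻¹ * (2 * B + 2))
        (fun N => ?_) ?_
      · have : T (S N) - S N = ((N : ℝ) + 1)⁻¹ • ((T ^ (N + 1)) 1 - 1) := by
          rw [hS]
          simp only [map_smul, map_sum, ← mul_apply_eq_comp, ← pow_succ', ← smul_sub,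
            ← Finset.sum_sub_distrib]
          rw [Finset.sum_range_sub (fun n => (T ^ n) (1 : C(X, ℝ)))]
          simp
        rw [this, norm_smul, norm_inv, Real.norm_of_nonneg (by positivity)]
        gcongr
        rw [ContinuousMap.norm_le _ (by positivity)]
        intro x
        rw [Real.norm_eq_abs, abs_le]
        simp only [ContinuousMap.sub_apply, ContinuousMap.one_apply]
        constructor <;> linarith [hnn (N + 1) x, hle (N + 1) x]
      · have := (tendsto_inv_atTop_zero.comp
          (tendsto_atTop_add_const_right atTop (1 : ℝ) tendsto_natCast_atTop_atTop)).mul_const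
          (2 * B + 2)
        simpa using this
    have h2 : Tendsto (fun j => T (S (θ j)) - S (θ j)) atTop (𝓝 (T h - h)) :=
      ((T.continuous.tendsto h).comp hlim).sub hlim
    exact sub_eq_zero.1 (tendsto_nhds_unique h2 (h1.comp hθ.tendsto_atTop))

theorem norm_pow_apply_le {T : C(X, ℝ) →L[ℝ] C(X, ℝ)} (hpos : ∀ u, 0 ≤ u → 0 ≤ T u) {B : ℝ}
    (hB : 0 < B) (hle : ∀ n x, (T ^ n) 1 x ≤ B) (n : ℕ) (u : C(X, ℝ)) :
    ‖(T ^ n) u‖ ≤ B * ‖u‖ := by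
  rw [ContinuousMap.norm_le _ (by positivity)]
  intro x
  have hu : u ≤ ‖u‖ • 1 := fun y => by simpa using u.apply_le_norm y
  have hu' : -(‖u‖ • 1) ≤ u := fun y => by simpa using u.neg_norm_le_apply y
  have h1 := ContinuousMap.le_def.1 (iterate_le_of_positive hpos n hu) x
  have h2 := ContinuousMap.le_def.1 (iterate_le_of_positive hpos n hu') x
  simp only [map_neg, map_smul, ContinuousMap.neg_apply, ContinuousMap.smul_apply,
    smul_eq_mul] at h1 h2
  have h3 := mul_le_mul_of_nonneg_left (hle n x) (norm_nonneg u)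
  rw [Real.norm_eq_abs, abs_le]
  constructor <;> linarith

/-- If an orbit of a positive operator with positive fixed function `h` is relatively compact and
the operator improves positivity in the sense of `hex`, the orbit converges to a multiple
of `h`. -/
theorem exists_tendsto_smul_fixed [Nonempty X] {T : C(X, ℝ) →L[ℝ] C(X, ℝ)}
    (hpos : ∀ u, 0 ≤ u → 0 ≤ T u)
    (hex : ∀ u, 0 ≤ u → (∀ k, ∃ x, (T ^ k) u x = 0) → u = 0) {B : ℝ} (hB : 0 < B)
    (hle : ∀ n x, (T ^ n) 1 x ≤ B) {h : C(X, ℝ)} (hh : ∀ x, 0 < h x) (hfix : T h = h)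
    {v : C(X, ℝ)} (heq : Equicontinuous fun n => ((T ^ n) v : X → ℝ)) :
    ∃ c : ℝ, Tendsto (fun n => (T ^ n) v) atTop (𝓝 (c • h)) := by
  have hbd : ∀ n, ‖(T ^ n) v‖ ≤ B * ‖v‖ := fun n => norm_pow_apply_le hpos hB hle n v
  have hfixn : ∀ n, (T ^ n) h = h := fun n => by
    induction n with
    | zero => simp
    | succ n ih => rw [pow_succ', mul_apply_eq_comp, ih, hfix]
  obtain ⟨G, θ, hθ, hlim⟩ := exists_subseq_tendsto_of_equicontinuous (fun n => (T ^ n) v)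
    (fun n x => ((T ^ n) v).norm_coe_le_norm x |>.trans (hbd n)) heq
  obtain ⟨x₀, -, hx₀⟩ :=
    isCompact_univ.exists_isMinOn Set.univ_nonempty h.continuous.continuousOn
  replace hx₀ : ∀ x, h x₀ ≤ h x := fun x => hx₀ (Set.mem_univ x)
  set A : Set ℝ := {c | ∃ n, (T ^ n) v ≤ c • h}
  have hAne : A.Nonempty := by
    refine ⟨‖v‖ / h x₀, 0, fun x => ?_⟩
    have h1 := v.apply_le_norm x
    have h2 : ‖v‖ / h x₀ * h x₀ ≤ ‖v‖ / h x₀ * h x :=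
      mul_le_mul_of_nonneg_left (hx₀ x) (div_nonneg (norm_nonneg _) (hh _).le)
    rw [div_mul_cancel₀ _ (hh x₀).ne'] at h2
    simpa using h1.trans h2
  have hAbdd : BddBelow A := by
    refine ⟨-(B * ‖v‖) / h x₀, ?_⟩
    rintro c ⟨n, hn⟩
    have h1 := ContinuousMap.le_def.1 hn x₀
    have h2 := ((T ^ n) v).neg_norm_le_apply x₀
    rw [div_le_iff₀ (hh x₀)]
    simp only [ContinuousMap.smul_apply, smul_eq_mul] at h1
    linarith [hbd n]
  set c := sInf A
  have hGle : G ≤ c • h := by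
    have key : ∀ c' ∈ A, G ≤ c' • h := by
      rintro c' ⟨n, hn⟩
      refine ContinuousMap.le_def.2 fun x => le_of_tendsto
        (((continuous_eval_const x).tendsto G).comp hlim) ?_
      filter_upwards [hθ.tendsto_atTop.eventually_ge_atTop n] with j hj
      have := iterate_le_of_positive hpos (θ j - n) hn
      rw [← mul_apply_eq_comp, ← pow_add, Nat.sub_add_cancel hj, map_smul,
        hfixn, ContinuousMap.le_def] at this
      exact this x
    intro x
    have : G x / h x ≤ c := le_csInf hAne fun c' hc' => by
      rw [div_le_iff₀ (hh x)]
      simpa using key c' hc' x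
    rw [div_le_iff₀ (hh x)] at this
    simpa using this
  have hG : c • h - G = 0 := by
    refine hex _ (sub_nonneg.2 hGle) fun k => ?_
    have hnn := iterate_le_of_positive hpos k (sub_nonneg.2 hGle)
    rw [map_zero] at hnn
    obtain ⟨x₁, -, hx₁⟩ := isCompact_univ.exists_isMinOn Set.univ_nonempty
      ((T ^ k) (c • h - G)).continuous.continuousOn
    replace hx₁ : ∀ x, (T ^ k) (c • h - G) x₁ ≤ (T ^ k) (c • h - G) x :=
      fun x => hx₁ (Set.mem_univ x)
    refine ⟨x₁, le_antisymm ?_ (hnn x₁)⟩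
    by_contra! hη
    set η := (T ^ k) (c • h - G) x₁ with hηdef
    have hlimk : Tendsto (fun j => (T ^ (k + θ j)) v) atTop (𝓝 ((T ^ k) G)) := by
      refine (((T ^ k).continuous.tendsto G).comp hlim).congr fun j => ?_
      simp [pow_add]
    obtain ⟨j, hj⟩ := ((Metric.tendsto_nhds.1 hlimk) (η / 2) (by linarith)).exists
    rw [dist_eq_norm] at hj
    have hhn : 0 < ‖h‖ := (hh x₀).trans_le (h.apply_le_norm x₀)
    have hmem : c - η / (2 * ‖h‖) ∈ A := by
      refine ⟨k + θ j, ContinuousMap.le_def.2 fun x => ?_⟩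
      have h1 := ((T ^ (k + θ j)) v - (T ^ k) G).apply_le_norm x
      have h2 := hx₁ x
      rw [map_sub, map_smul, hfixn] at h2
      simp only [ContinuousMap.sub_apply, ContinuousMap.smul_apply, smul_eq_mul] at h1 h2 ⊢
      have h3 : η / (2 * ‖h‖) * h x ≤ η / (2 * ‖h‖) * ‖h‖ :=
        mul_le_mul_of_nonneg_left (h.apply_le_norm x) (by positivity)
      have h4 : η / (2 * ‖h‖) * ‖h‖ = η / 2 := by field_simp
      linarith
    have := csInf_le hAbdd hmem
    have : 0 < η / (2 * ‖h‖) := by positivity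
    linarith
  refine ⟨c, ?_⟩
  rw [← sub_eq_zero.1 hG] at hlim
  rw [Metric.tendsto_atTop]
  intro ε hε
  obtain ⟨j, hj⟩ := ((Metric.tendsto_nhds.1 hlim) (ε / B) (by positivity)).exists
  refine ⟨θ j, fun n hn => ?_⟩
  have h1 := norm_pow_apply_le hpos hB hle (n - θ j) ((T ^ θ j) v - c • h)
  rw [map_sub, map_smul, hfixn, ← mul_apply_eq_comp, ← pow_add,
    Nat.sub_add_cancel hn] at h1
  rw [dist_eq_norm]
  refine h1.trans_lt ?_
  rw [← lt_div_iff₀' hB, ← dist_eq_norm]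
  exact hj

/-- A Perron–Frobenius theorem for positive operators on `C(X, ℝ)`. -/
theorem exists_perron_frobenius [Nonempty X] {T : C(X, ℝ) →L[ℝ] C(X, ℝ)}
    (hpos : ∀ u, 0 ≤ u → 0 ≤ T u)
    (hex : ∀ u, 0 ≤ u → (∀ k, ∃ x, (T ^ k) u x = 0) → u = 0) {B : ℝ} (hB : 0 < B)
    (hle : ∀ n x, (T ^ n) 1 x ≤ B) (hge : ∀ n x, 1 ≤ B * (T ^ n) 1 x)
    (heq : ∀ v : C(X, ℝ), (∀ x, 0 < v x) → RatioEquicontinuous fun n => ((T ^ n) v : X → ℝ)) :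
    ∃ (h : C(X, ℝ)) (ℓ : C(X, ℝ) →ₗ[ℝ] ℝ), (∀ x, 0 < h x) ∧ T h = h ∧ ℓ 1 = 1 ∧
      (∀ v, 0 ≤ v → 0 ≤ ℓ v) ∧ (∀ v, ℓ (T v) = ℓ v) ∧
      ∀ v, Tendsto (fun n => (T ^ n) v) atTop (𝓝 (ℓ v • h)) := by
  obtain ⟨h₀, hh₀, hfix₀⟩ := exists_pos_fixed hB hle hge (heq 1 fun _ => one_pos)
  have hconv₀ : ∀ v : C(X, ℝ), (∀ x, 0 < v x) →
      ∃ c : ℝ, Tendsto (fun n => (T ^ n) v) atTop (𝓝 (c • h₀)) := fun v hv =>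
    exists_tendsto_smul_fixed hpos hex hB hle hh₀ hfix₀
      ((heq v hv).equicontinuous fun n x =>
        (((T ^ n) v).apply_le_norm x).trans (norm_pow_apply_le hpos hB hle n v))
  obtain ⟨c₁, hc₁⟩ := hconv₀ 1 fun _ => one_pos
  have heval : ∀ (x : X) {w : ℕ → C(X, ℝ)} {g : C(X, ℝ)}, Tendsto w atTop (𝓝 g) →
      Tendsto (fun n => w n x) atTop (𝓝 (g x)) := fun x w g hw =>
    ((continuous_eval_const x).tendsto g).comp hw
  obtain ⟨x₀⟩ := ‹Nonempty X›
  have hc₁pos : 0 < c₁ := by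
    have h1 : B⁻¹ ≤ c₁ * h₀ x₀ := by
      refine ge_of_tendsto (heval x₀ hc₁) (Eventually.of_forall fun n => ?_)
      exact (inv_le_iff_one_le_mul₀' hB).2 (hge n x₀)
    exact pos_of_mul_pos_left ((inv_pos.2 hB).trans_le h1) (hh₀ x₀).le
  set h := c₁ • h₀ with hdef
  have hh : ∀ x, 0 < h x := fun x => mul_pos hc₁pos (hh₀ x)
  have hconv : ∀ v : C(X, ℝ), ∃ c : ℝ, Tendsto (fun n => (T ^ n) v) atTop (𝓝 (c • h)) := by
    intro v
    obtain ⟨c, hc⟩ := hconv₀ (v + (‖v‖ + 1) • 1) fun x => by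
      have := v.neg_norm_le_apply x
      simp only [ContinuousMap.add_apply, ContinuousMap.smul_apply, ContinuousMap.one_apply,
        smul_eq_mul]
      linarith
    refine ⟨c / c₁ - (‖v‖ + 1), ?_⟩
    have h1 := hc.sub (hc₁.const_smul (‖v‖ + 1))
    have h2 : c • h₀ - (‖v‖ + 1) • c₁ • h₀ = (c / c₁ - (‖v‖ + 1)) • h := by
      rw [hdef, sub_smul, smul_smul (c / c₁), div_mul_cancel₀ _ hc₁pos.ne']
    rw [h2] at h1
    refine h1.congr fun n => ?_
    rw [map_add, map_smul, add_sub_cancel_right]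
  choose ℓ hℓ using hconv
  have huniq : ∀ {v : C(X, ℝ)} {c : ℝ}, Tendsto (fun n => (T ^ n) v) atTop (𝓝 (c • h)) →
      ℓ v = c := fun {v c} hv => by
    have := congrArg (fun g : C(X, ℝ) => g x₀) (tendsto_nhds_unique (hℓ v) hv)
    exact mul_right_cancel₀ (hh x₀).ne' this
  refine ⟨h, ⟨⟨ℓ, fun u v => huniq ?_⟩, fun c v => huniq ?_⟩, hh, ?_, ?_, ?_, ?_, hℓ⟩
  · simpa [add_smul] using (hℓ u).add (hℓ v)
  · simpa [mul_smul] using (hℓ v).const_smul c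
  · rw [hdef, map_smul, hfix₀]
  · exact huniq (by simpa using hc₁)
  · intro v hv
    have h1 : 0 ≤ ℓ v * h x₀ := ge_of_tendsto (heval x₀ (hℓ v)) (Eventually.of_forall fun n => by
      simpa using iterate_le_of_positive hpos n hv x₀)
    exact nonneg_of_mul_nonneg_left h1 (hh x₀)
  · intro v
    refine huniq (((hℓ v).comp (tendsto_add_atTop_nat 1)).congr fun n => ?_)
    simp

end Abstract

section Words

variable {α : Type*}

theorem shift_iterate_apply (n : ℕ) (x : ℕ → α) (k : ℕ) : shift^[n] x k = x (k + n) := by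
  induction n generalizing k with
  | zero => rfl
  | succ n ih =>
    rw [Function.iterate_succ_apply', shift, ih]
    congr 1
    omega

theorem shift_iterate_eq_cons {n : ℕ} {x z : ℕ → α} (h : shift^[n + 1] z = x) :
    shift^[n] z = cons (z n) x := by
  funext k
  rcases k with _ | k
  · simp [shift_iterate_apply, cons]
  · simp only [cons, ← h, shift_iterate_apply]
    congr 1
    omega

theorem shift_iterate_succ_of_eq_cons {n : ℕ} {a : α} {x z : ℕ → α}
    (h : shift^[n] z = cons a x) : z n = a ∧ shift^[n + 1] z = x := by
  constructor
  · have := congrFun h 0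
    simpa [shift_iterate_apply, cons] using this
  · rw [Function.iterate_succ_apply', h]
    rfl

theorem consW_shift_iterate {n : ℕ} (z : ℕ → α) :
    consW (fun i : Fin n => z i) (shift^[n] z) = z := by
  funext k
  by_cases hk : k < n
  · simp [consW, hk]
  · simp only [consW, hk, dite_false, shift_iterate_apply]
    congr 1
    omega

theorem shift_iterate_consW {n : ℕ} (a : Fin n → α) (x : ℕ → α) :
    shift^[n] (consW a x) = x := by
  funext k
  simp [shift_iterate_apply, consW]

theorem birk_add (f : (ℕ → α) → ℝ) (m n : ℕ) (x : ℕ → α) :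
    birk f (m + n) x = birk f m x + birk f n (shift^[m] x) := by
  rw [birk, Finset.sum_range_add]
  congr 1
  refine Finset.sum_congr rfl fun i _ => ?_
  rw [add_comm, Function.iterate_add_apply]

theorem birk_succ (f : (ℕ → α) → ℝ) (n : ℕ) (x : ℕ → α) :
    birk f (n + 1) x = birk f n x + f (shift^[n] x) :=
  Finset.sum_range_succ _ _

theorem ruelle_nonneg [MeasurableSpace α] (μ : Measure α) (f : (ℕ → α) → ℝ) {φ : (ℕ → α) → ℝ} (hφ : ∀ x, 0 ≤ φ x)
    (x : ℕ → α) : 0 ≤ ruelle μ f φ x :=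
  integral_nonneg fun _ => mul_nonneg (Real.exp_pos _).le (hφ _)

end Words

section Dynamics

open Topology

variable {N : Type*} [MetricSpace N]

theorem continuous_cons : Continuous fun p : N × (ℕ → N) => cons p.1 p.2 := by
  refine continuous_pi fun k => ?_
  rcases k with _ | k
  · exact continuous_fst
  · exact (continuous_apply k).comp continuous_snd

theorem dist_term_le [CompactSpace N] (x y : ℕ → N) (n : ℕ) :
    (1 / 2 : ℝ) ^ (n + 1) * dist (x n) (y n) ≤
      (1 / 2 : ℝ) ^ (n + 1) * Metric.diam (Set.univ : Set N) := by
  gcongr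
  exact Metric.dist_le_diam_of_mem isCompact_univ.isBounded (Set.mem_univ _) (Set.mem_univ _)

theorem hasSum_half_pow_succ_mul (c : ℝ) : HasSum (fun n : ℕ => (1 / 2 : ℝ) ^ (n + 1) * c) c := by
  have := (hasSum_geometric_two' (1 : ℝ)).mul_right c
  rw [one_mul] at this
  refine this.congr_fun fun n => ?_
  rw [pow_succ, one_div_pow]
  ring

theorem summable_dOmega [CompactSpace N] (x y : ℕ → N) :
    Summable fun n : ℕ => (1 / 2 : ℝ) ^ (n + 1) * dist (x n) (y n) :=
  Summable.of_nonneg_of_le (fun _ => by positivity) (dist_term_le x y)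
    (hasSum_half_pow_succ_mul _).summable

theorem dOmega_le_diam [CompactSpace N] (x y : ℕ → N) :
    dOmega x y ≤ Metric.diam (Set.univ : Set N) :=
  ((summable_dOmega x y).tsum_le_tsum (dist_term_le x y)
    (hasSum_half_pow_succ_mul _).summable).trans_eq (hasSum_half_pow_succ_mul _).tsum_eq

theorem dOmega_nonneg (x y : ℕ → N) : 0 ≤ dOmega x y := tsum_nonneg fun _ => by positivity

theorem dOmega_self (x : ℕ → N) : dOmega x x = 0 := by simp [dOmega]

theorem eq_of_dOmega_eq_zero [CompactSpace N] {x y : ℕ → N} (h : dOmega x y = 0) : x = y := by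
  have h0 := (summable_dOmega x y).hasSum
  rw [← dOmega, h, hasSum_zero_iff_of_nonneg fun _ => by positivity] at h0
  funext n
  simpa using congrFun h0 n

theorem continuous_dOmega [CompactSpace N] :
    Continuous fun p : (ℕ → N) × (ℕ → N) => dOmega p.1 p.2 := by
  refine continuous_tsum (fun n => by fun_prop)
    (hasSum_half_pow_succ_mul (Metric.diam (Set.univ : Set N))).summable fun n p => ?_
  rw [Real.norm_of_nonneg (by positivity)]
  exact dist_term_le p.1 p.2 n

theorem dOmega_eq_of_agree [CompactSpace N] {n : ℕ} {z w : ℕ → N} (h : ∀ k < n, z k = w k) :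
    dOmega z w = (1 / 2 : ℝ) ^ n * dOmega (shift^[n] z) (shift^[n] w) := by
  rw [dOmega, dOmega, ← tsum_mul_left, ← (summable_dOmega z w).sum_add_tsum_nat_add n,
    Finset.sum_eq_zero fun k hk => by simp [h k (Finset.mem_range.1 hk)], zero_add]
  refine tsum_congr fun k => ?_
  simp only [shift_iterate_apply]
  ring

/-- Continuous functions are uniformly continuous with respect to `dOmega`. -/
theorem exists_abs_sub_lt_of_dOmega_le [CompactSpace N] {g : (ℕ → N) → ℝ} (hg : Continuous g)
    {ε : ℝ} (hε : 0 < ε) : ∃ δ > 0, ∀ z w, dOmega z w ≤ δ → |g z - g w| < ε := by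
  set K : Set ((ℕ → N) × (ℕ → N)) := {p | ε ≤ |g p.1 - g p.2|}
  have hK : IsCompact K := (isClosed_le continuous_const (by fun_prop)).isCompact
  rcases K.eq_empty_or_nonempty with hne | hne
  · refine ⟨1, one_pos, fun z w _ => ?_⟩
    by_contra! h
    exact hne.subset (show (z, w) ∈ K from h)
  · obtain ⟨p, hp, hmin⟩ := hK.exists_isMinOn hne continuous_dOmega.continuousOn
    have hpos : 0 < dOmega p.1 p.2 := by
      refine (dOmega_nonneg _ _).lt_of_ne fun h => ?_
      have hp' : ε ≤ |g p.1 - g p.2| := hp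
      rw [eq_of_dOmega_eq_zero h.symm, sub_self, abs_zero] at hp'
      exact hp'.not_gt hε
    refine ⟨dOmega p.1 p.2 / 2, half_pos hpos, fun z w hzw => ?_⟩
    by_contra! h
    have : dOmega p.1 p.2 ≤ dOmega z w := hmin (show (z, w) ∈ K from h)
    linarith

theorem WeakWalters.exists_birk_le {f : (ℕ → N) → ℝ} (hf : WeakWalters f) {ε : ℝ} (hε : 0 < ε) :
    ∃ δ > 0, ∀ (n : ℕ) (z w : ℕ → N), (∀ k < n, z k = w k) →
      dOmega (shift^[n] z) (shift^[n] w) ≤ δ → birk f n z ≤ birk f n w + ε := by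
  obtain ⟨δ, hδ, h⟩ := hf ε hε
  refine ⟨δ, hδ, fun n z w hzw hd => ?_⟩
  rcases n with _ | n
  · simpa [birk] using hε.le
  · have hz : consW (fun i : Fin (n + 1) => z i) (shift^[n + 1] z) = z := consW_shift_iterate z
    have hw : consW (fun i : Fin (n + 1) => z i) (shift^[n + 1] w) = w := by
      rw [show (fun i : Fin (n + 1) => z i) = fun i : Fin (n + 1) => w i from
        funext fun i => hzw i i.2, consW_shift_iterate]
    have h1 : ((birk f (n + 1) (consW (fun i : Fin (n + 1) => z i) (shift^[n + 1] z)) -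
        birk f (n + 1) (consW (fun i : Fin (n + 1) => z i) (shift^[n + 1] w)) : ℝ) : EReal) ≤
        Cf f (shift^[n + 1] z) (shift^[n + 1] w) :=
      le_iSup_of_le n (le_iSup_of_le (fun i : Fin (n + 1) => z i) le_rfl)
    rw [hz, hw] at h1
    have h2 := EReal.coe_le_coe_iff.1 (h1.trans (h _ _ hd))
    linarith

/-- Under the weak Walters condition, Birkhoff sums along a common prefix differ by a bounded
amount. -/
theorem WeakWalters.exists_birk_le_add [CompactSpace N] {f : (ℕ → N) → ℝ} (hf : WeakWalters f)
    (hc : Continuous f) : ∃ D : ℝ, ∀ (n : ℕ) (z w : ℕ → N), (∀ k < n, z k = w k) →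
      birk f n z ≤ birk f n w + D := by
  obtain ⟨δ, hδ, h⟩ := hf.exists_birk_le one_pos
  set R := Metric.diam (Set.univ : Set N)
  have hR : 0 ≤ R := Metric.diam_nonneg
  obtain ⟨k, hk⟩ : ∃ k : ℕ, (1 / 2 : ℝ) ^ k * R ≤ δ := by
    obtain ⟨k, hk⟩ := exists_pow_lt_of_lt_one (show 0 < δ / (R + 1) by positivity)
      (show (1 / 2 : ℝ) < 1 by norm_num)
    refine ⟨k, ?_⟩
    rw [lt_div_iff₀ (by positivity)] at hk
    nlinarith [pow_pos (show (0 : ℝ) < 1 / 2 by norm_num) k]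
  obtain ⟨C, hC0, hC⟩ : ∃ C : ℝ, 0 ≤ C ∧ ∀ x, |f x| ≤ C :=
    ⟨_, norm_nonneg _, (⟨f, hc⟩ : C(ℕ → N, ℝ)).norm_coe_le_norm⟩
  have hbirk : ∀ n x, |birk f n x| ≤ n * C := fun n x => by
    refine (Finset.abs_sum_le_sum_abs _ _).trans ((Finset.sum_le_sum fun i _ => hC _).trans ?_)
    simp
  have hshort : ∀ n ≤ k, ∀ z w, birk f n z ≤ birk f n w + 2 * (k * C) := fun n hn z w => by
    have h1 := (abs_le.1 (hbirk n z)).2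
    have h2 := (abs_le.1 (hbirk n w)).1
    have h3 : (n : ℝ) * C ≤ k * C := by gcongr
    linarith
  refine ⟨1 + 2 * (k * C), fun n z w hzw => ?_⟩
  rcases le_total n k with hn | hn
  · linarith [hshort n hn z w]
  · obtain ⟨m, rfl⟩ := Nat.exists_eq_add_of_le' hn
    rw [birk_add, birk_add]
    have h1 := h m z w (fun i hi => hzw i (by omega)) (by
      rw [dOmega_eq_of_agree (n := k) fun i hi => by
        rw [shift_iterate_apply, shift_iterate_apply]; exact hzw _ (by omega)]
      exact (mul_le_mul_of_nonneg_left (dOmega_le_diam _ _) (by positivity)).trans hk)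
    linarith [hshort k le_rfl (shift^[m] z) (shift^[m] w)]

theorem continuous_ruelle_integrand {f φ : (ℕ → N) → ℝ} (hf : Continuous f) (hφ : Continuous φ)
    (x : ℕ → N) : Continuous fun a => Real.exp (f (cons a x)) * φ (cons a x) := by
  have hcons : Continuous fun a : N => cons a x :=
    continuous_cons.comp (continuous_id.prodMk continuous_const)
  exact (Real.continuous_exp.comp (hf.comp hcons)).mul (hφ.comp hcons)

end Dynamics

section Operator

open Topology

variable [CompactSpace M] [BorelSpace M]

theorem continuous_ruelle (μ : Measure M) [IsFiniteMeasure μ] {f φ : (ℕ → M) → ℝ}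
    (hf : Continuous f) (hφ : Continuous φ) : Continuous (ruelle μ f φ) := by
  have hcons : Continuous fun p : (ℕ → M) × M => cons p.2 p.1 :=
    continuous_cons.comp continuous_swap
  have := continuous_parametric_integral_of_continuous (μ := μ)
    (f := fun (x : ℕ → M) (a : M) => Real.exp (f (cons a x)) * φ (cons a x))
    ((Real.continuous_exp.comp (hf.comp hcons)).mul (hφ.comp hcons)) isCompact_univ
  rw [Measure.restrict_univ] at this
  exact this

theorem integrable_ruelle_integrand (μ : Measure M) [IsFiniteMeasure μ] {f φ : (ℕ → M) → ℝ}
    (hf : Continuous f) (hφ : Continuous φ) (x : ℕ → M) :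
    Integrable (fun a => Real.exp (f (cons a x)) * φ (cons a x)) μ :=
  (continuous_ruelle_integrand hf hφ x).integrable_of_hasCompactSupport
    (HasCompactSupport.of_compactSpace _)

theorem ruelle_pos (μ : Measure M) [IsProbabilityMeasure μ] {f φ : (ℕ → M) → ℝ}
    (hf : Continuous f) (hc : Continuous φ) (hφ : ∀ x, 0 < φ x) (x : ℕ → M) :
    0 < ruelle μ f φ x := by
  have hpos : ∀ a, 0 < Real.exp (f (cons a x)) * φ (cons a x) := fun a =>
    mul_pos (Real.exp_pos _) (hφ _)
  rw [ruelle, integral_pos_iff_support_of_nonneg (fun a => (hpos a).le)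
    (integrable_ruelle_integrand μ hf hc x)]
  rw [Set.eq_univ_of_forall fun a => Function.mem_support.2 (hpos a).ne', measure_univ]
  exact one_pos

/-- The Ruelle operator as a bounded operator on continuous functions. -/
def ruelleCLM (μ : Measure M) [IsFiniteMeasure μ] (f : C(ℕ → M, ℝ)) :
    C(ℕ → M, ℝ) →L[ℝ] C(ℕ → M, ℝ) :=
  LinearMap.mkContinuous
    { toFun := fun φ => ⟨ruelle μ f φ, continuous_ruelle μ f.continuous φ.continuous⟩
      map_add' := fun φ ψ => by
        ext x
        simp only [ContinuousMap.coe_mk, ContinuousMap.add_apply, ruelle, mul_add]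
        exact integral_add (integrable_ruelle_integrand μ f.continuous φ.continuous x)
          (integrable_ruelle_integrand μ f.continuous ψ.continuous x)
      map_smul' := fun c φ => by
        ext x
        simp only [ContinuousMap.coe_mk, ContinuousMap.smul_apply, ruelle, smul_eq_mul,
          RingHom.id_apply, mul_left_comm _ c, integral_const_mul] }
    (Real.exp ‖f‖ * μ.real Set.univ) fun φ => by
      refine (ContinuousMap.norm_le _ (by positivity)).2 fun x => ?_
      calc _ ≤ Real.exp ‖f‖ * ‖φ‖ * μ.real Set.univ := by
            refine norm_integral_le_of_norm_le_const (Eventually.of_forall fun a => ?_)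
            rw [norm_mul, Real.norm_of_nonneg (Real.exp_pos _).le]
            gcongr
            · exact f.apply_le_norm _
            · exact φ.norm_coe_le_norm _
        _ = _ := by ring

@[simp]
theorem ruelleCLM_apply (μ : Measure M) [IsFiniteMeasure μ] (f φ : C(ℕ → M, ℝ)) (x : ℕ → M) :
    ruelleCLM μ f φ x = ruelle μ f φ x := rfl

theorem coe_ruelleCLM_pow (μ : Measure M) [IsFiniteMeasure μ] (f φ : C(ℕ → M, ℝ)) (n : ℕ) :
    ((ruelleCLM μ f ^ n) φ : (ℕ → M) → ℝ) = (ruelle μ f)^[n] φ := by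
  induction n with
  | zero => rfl
  | succ n ih =>
    rw [pow_succ', mul_apply_eq_comp, Function.iterate_succ_apply', ← ih]
    rfl

/-- Comparison of iterates of the Ruelle operator at two points, prefix by prefix. -/
theorem ruelleCLM_pow_le (μ : Measure M) [IsFiniteMeasure μ] (f φ ψ : C(ℕ → M, ℝ)) (n : ℕ)
    (x y : ℕ → M) (c d : ℝ)
    (h : ∀ z w : ℕ → M, (∀ k < n, z k = w k) → shift^[n] z = x → shift^[n] w = y →
      c * (Real.exp (birk f n z) * φ z) ≤ d * (Real.exp (birk f n w) * ψ w)) :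
    c * (ruelleCLM μ f ^ n) φ x ≤ d * (ruelleCLM μ f ^ n) ψ y := by
  induction n generalizing x y c d with
  | zero => simpa [birk] using h x y (by simp) rfl rfl
  | succ n ih =>
    simp only [pow_succ', mul_apply_eq_comp, ruelleCLM_apply, ruelle, ← integral_const_mul]
    refine integral_mono
      ((integrable_ruelle_integrand μ f.continuous (ContinuousMap.continuous _) x).const_mul c)
      ((integrable_ruelle_integrand μ f.continuous (ContinuousMap.continuous _) y).const_mul d)
      fun a => ?_
    simp only [← mul_assoc]
    refine ih _ _ _ _ fun z w hzw hz hw => ?_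
    obtain ⟨hz1, hz2⟩ := shift_iterate_succ_of_eq_cons hz
    obtain ⟨hw1, hw2⟩ := shift_iterate_succ_of_eq_cons hw
    have := h z w (fun k hk => by
      rcases Nat.lt_succ_iff_lt_or_eq.1 hk with hk | rfl
      · exact hzw k hk
      · rw [hz1, hw1]) hz2 hw2
    rw [birk_succ, birk_succ, Real.exp_add, Real.exp_add, hz, hw] at this
    linarith

theorem ruelleCLM_nonneg (μ : Measure M) [IsFiniteMeasure μ] (f : C(ℕ → M, ℝ))
    {u : C(ℕ → M, ℝ)} (hu : 0 ≤ u) : 0 ≤ ruelleCLM μ f u :=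
  ContinuousMap.le_def.2 (ruelle_nonneg μ f (ContinuousMap.le_def.1 hu))

theorem ruelleCLM_pow_pos (μ : Measure M) [IsProbabilityMeasure μ] (f : C(ℕ → M, ℝ))
    {u : C(ℕ → M, ℝ)} (hu : ∀ x, 0 < u x) (n : ℕ) (x : ℕ → M) :
    0 < (ruelleCLM μ f ^ n) u x := by
  induction n generalizing x with
  | zero => simpa using hu x
  | succ n ih =>
    rw [pow_succ', mul_apply_eq_comp]
    exact ruelle_pos μ f.continuous (ContinuousMap.continuous _) ih x

theorem ratioEquicontinuous_ruelleCLM_pow (μ : Measure M) [IsFiniteMeasure μ] {f : C(ℕ → M, ℝ)}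
    (hf : WeakWalters f) {v : C(ℕ → M, ℝ)} (hv : ∀ x, 0 < v x) :
    RatioEquicontinuous fun n => ((ruelleCLM μ f ^ n) v : (ℕ → M) → ℝ) := by
  intro r hr x
  have hε : 0 < Real.log r / 2 := half_pos (Real.log_pos hr)
  obtain ⟨δ₁, hδ₁, h₁⟩ := hf.exists_birk_le hε
  obtain ⟨δ₂, hδ₂, h₂⟩ := exists_abs_sub_lt_of_dOmega_le
    (v.continuous.log fun x => (hv x).ne') hε
  have key : ∀ a b, dOmega a b < min δ₁ δ₂ → ∀ n,
      (ruelleCLM μ f ^ n) v a ≤ r * (ruelleCLM μ f ^ n) v b := fun a b hab n => by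
    rw [← one_mul ((ruelleCLM μ f ^ n) v a)]
    refine ruelleCLM_pow_le μ f v v n a b 1 r fun z w hzw hz hw => ?_
    have hd := hab.le
    rw [← hz, ← hw] at hd
    have e1 := h₁ n z w hzw (hd.trans (min_le_left _ _))
    have e2 := h₂ z w (by
      rw [dOmega_eq_of_agree hzw]
      refine (mul_le_of_le_one_left (dOmega_nonneg _ _) ?_).trans (hd.trans (min_le_right _ _))
      exact pow_le_one₀ (by norm_num) (by norm_num))
    have e3 := (abs_lt.1 e2).2
    rw [one_mul]
    calc Real.exp (birk f n z) * v z
        = Real.exp (birk f n z + Real.log (v z)) := by rw [Real.exp_add, Real.exp_log (hv z)]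
      _ ≤ Real.exp (Real.log r + (birk f n w + Real.log (v w))) :=
          Real.exp_le_exp.2 (by linarith)
      _ = _ := by
          rw [Real.exp_add, Real.exp_add, Real.exp_log (hv w), Real.exp_log (by linarith)]
  have hcont₁ : Continuous fun y => dOmega y x :=
    continuous_dOmega.comp (continuous_id.prodMk continuous_const)
  have hcont₂ : Continuous fun y => dOmega x y :=
    continuous_dOmega.comp (continuous_const.prodMk continuous_id)
  have hlt : 0 < min δ₁ δ₂ := lt_min hδ₁ hδ₂
  filter_upwards [(hcont₁.tendsto x).eventually_lt_const (by rwa [dOmega_self]),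
    (hcont₂.tendsto x).eventually_lt_const (by rwa [dOmega_self])] with y hy₁ hy₂ n
  exact ⟨key y x hy₁ n, key x y hy₂ n⟩

theorem eq_zero_of_ruelleCLM_pow_eq_zero (μ : Measure M) [IsFiniteMeasure μ]
    [μ.IsOpenPosMeasure] (f : C(ℕ → M, ℝ)) {u : C(ℕ → M, ℝ)} (hu : 0 ≤ u) (n : ℕ) {x : ℕ → M}
    (hx : (ruelleCLM μ f ^ n) u x = 0) {z : ℕ → M} (hz : shift^[n] z = x) : u z = 0 := by
  induction n generalizing x with
  | zero => simpa [← hz] using hx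
  | succ n ih =>
    rw [pow_succ', mul_apply_eq_comp, ruelleCLM_apply, ruelle] at hx
    have hnn := iterate_le_of_positive (fun u => ruelleCLM_nonneg μ f) n hu
    rw [map_zero] at hnn
    rw [integral_eq_zero_iff_of_nonneg (fun a => mul_nonneg (Real.exp_pos _).le
      (ContinuousMap.le_def.1 hnn _))
      (integrable_ruelle_integrand μ f.continuous (ContinuousMap.continuous _) x),
      (continuous_ruelle_integrand f.continuous (ContinuousMap.continuous _) x).ae_eq_iff_eq μ
        continuous_zero] at hx
    have := congrFun hx (z n)
    simp only [Pi.zero_apply, mul_eq_zero, Real.exp_ne_zero, false_or] at this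
    exact ih this (shift_iterate_eq_cons hz)

theorem eq_zero_of_forall_exists_ruelleCLM_pow_eq_zero (μ : Measure M) [IsFiniteMeasure μ]
    [μ.IsOpenPosMeasure] (f : C(ℕ → M, ℝ)) {u : C(ℕ → M, ℝ)} (hu : 0 ≤ u)
    (h : ∀ n, ∃ x, (ruelleCLM μ f ^ n) u x = 0) : u = 0 := by
  choose x hx using h
  ext y
  have hlim : Tendsto (fun n => consW (fun i : Fin n => y i) (x n)) atTop (𝓝 y) := by
    refine tendsto_pi_nhds.2 fun k => tendsto_const_nhds.congr' ?_
    filter_upwards [eventually_gt_atTop k] with n hn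
    simp [consW, hn]
  refine tendsto_nhds_unique ((u.continuous.tendsto y).comp hlim) (tendsto_const_nhds.congr
    fun n => ?_)
  exact (eq_zero_of_ruelleCLM_pow_eq_zero μ f hu n (hx n) (shift_iterate_consW _ _)).symm

theorem exists_ruelleCLM_pow_one_comparable (μ : Measure M) [IsProbabilityMeasure μ]
    {f : C(ℕ → M, ℝ)} (hf : WeakWalters f) :
    ∃ l B : ℝ, 0 < l ∧ 0 < B ∧ ∀ n x, (ruelleCLM μ f ^ n) 1 x ≤ B * l ^ n ∧
      l ^ n ≤ B * (ruelleCLM μ f ^ n) 1 x := by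
  obtain ⟨C, hC⟩ := hf.exists_birk_le_add f.continuous
  set D := Real.exp C
  have hD : 0 < D := Real.exp_pos C
  have hcomp : ∀ n x y, (ruelleCLM μ f ^ n) 1 x ≤ D * (ruelleCLM μ f ^ n) 1 y := fun n x y => by
    rw [← one_mul ((ruelleCLM μ f ^ n) 1 x)]
    refine ruelleCLM_pow_le μ f 1 1 n x y 1 D fun z w hzw _ _ => ?_
    simp only [ContinuousMap.one_apply, mul_one, one_mul, D, ← Real.exp_add]
    exact Real.exp_le_exp.2 (by linarith [hC n z w hzw])
  obtain ⟨a₀⟩ := nonempty_of_isProbabilityMeasure μ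
  set x₀ : ℕ → M := fun _ => a₀
  set a : ℕ → ℝ := fun n => (ruelleCLM μ f ^ n) 1 x₀ with hadef
  have ha : ∀ n, 0 < a n := fun n => ruelleCLM_pow_pos μ f (fun _ => one_pos) n x₀
  have hmono := fun n {u v : C(ℕ → M, ℝ)} (huv : u ≤ v) => ContinuousMap.le_def.1
    (iterate_le_of_positive (fun u => ruelleCLM_nonneg μ f) n huv) x₀
  obtain ⟨l, hl, hla⟩ := exists_pow_comparable_of_almost_multiplicative ha hD
    (fun m n => by
      have h1 := hmono m (u := (ruelleCLM μ f ^ n) 1) (v := (D * a n) • 1)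
        (ContinuousMap.le_def.2 fun x => by simpa [hadef] using hcomp n x x₀)
      rw [← mul_apply_eq_comp, ← pow_add, map_smul, ContinuousMap.smul_apply, smul_eq_mul] at h1
      linarith)
    (fun m n => by
      have h1 := hmono m (u := a n • 1) (v := D • (ruelleCLM μ f ^ n) 1)
        (ContinuousMap.le_def.2 fun x => by simpa [hadef] using hcomp n x₀ x)
      rw [map_smul, map_smul, ← mul_apply_eq_comp, ← pow_add, ContinuousMap.smul_apply,
        ContinuousMap.smul_apply, smul_eq_mul, smul_eq_mul] at h1
      linarith)
  refine ⟨l, D * D, hl, mul_pos hD hD, fun n x => ⟨?_, ?_⟩⟩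
  · rw [mul_assoc]
    exact (hcomp n x x₀).trans (mul_le_mul_of_nonneg_left (hla n).1 hD.le)
  · rw [mul_assoc]
    exact (hla n).2.trans (mul_le_mul_of_nonneg_left (hcomp n x₀ x) hD.le)

end Operator

/-- Riesz representation of normalized positive functionals on a compact space. -/
theorem exists_isProbabilityMeasure_forall_integral_eq {X : Type*} [TopologicalSpace X]
    [CompactSpace X] [T2Space X] [MeasurableSpace X] [BorelSpace X] (ℓ : C(X, ℝ) →ₗ[ℝ] ℝ)
    (hpos : ∀ v, 0 ≤ v → 0 ≤ ℓ v) (hone : ℓ 1 = 1) :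
    ∃ ν : Measure X, IsProbabilityMeasure ν ∧ ∀ v : C(X, ℝ), ∫ x, v x ∂ν = ℓ v := by
  let ℓc : CompactlySupportedContinuousMap X ℝ →ₗ[ℝ] ℝ :=
    { toFun := fun v => ℓ v.toContinuousMap
      map_add' := fun u v => map_add ℓ u.toContinuousMap v.toContinuousMap
      map_smul' := fun c v => map_smul ℓ c v.toContinuousMap }
  let Λ : CompactlySupportedContinuousMap X ℝ →ₚ[ℝ] ℝ :=
    PositiveLinearMap.mk₀ ℓc fun v hv => hpos _ hv
  have hrep : ∀ v : C(X, ℝ), ∫ x, v x ∂(RealRMK.rieszMeasure Λ) = ℓ v := fun v =>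
    RealRMK.integral_rieszMeasure Λ (CompactlySupportedContinuousMap.continuousMapEquiv v)
  refine ⟨RealRMK.rieszMeasure Λ, ⟨?_⟩, hrep⟩
  have h1 := hrep 1
  simp only [ContinuousMap.one_apply, integral_const, smul_eq_mul, mul_one, hone] at h1
  rwa [measureReal_def, ENNReal.toReal_eq_one_iff] at h1

/-- Ruelle–Perron–Frobenius on the Walters space: Let `μ` be a fully
supported Borel probability measure on the compact metric space `M` and let `f` be
continuous and satisfy the weak Walters condition.  Then there are `λ_f > 0`, a strictly
positive continuous `h_f`, and a Borel probability measure `ν_f` such that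
(i) `L_f h_f = λ_f h_f` and `∫ L_f φ dν_f = λ_f ∫ φ dν_f` for all continuous `φ`;
(ii) `‖λ_f^{-n} L_fⁿ φ − h_f ∫ φ dν_f‖₀ → 0` for every continuous `φ`;
moreover `ν_f` is the unique such probability eigenmeasure. -/
theorem statement13 [CompactSpace M] [BorelSpace M]
    (μ : Measure M) [IsProbabilityMeasure μ]
    (hsupp : ∀ U : Set M, IsOpen U → U.Nonempty → 0 < μ U)
    (f : (ℕ → M) → ℝ) (hf : Continuous f) (hWW : WeakWalters f) :
    ∃ lam : ℝ, 0 < lam ∧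
    ∃ hfun : (ℕ → M) → ℝ, Continuous hfun ∧ (∀ x, 0 < hfun x) ∧
    ∃ ν : Measure (ℕ → M), IsProbabilityMeasure ν ∧
      (∀ x, ruelle μ f hfun x = lam * hfun x) ∧
      (∀ φ : (ℕ → M) → ℝ, Continuous φ →
        ∫ z, ruelle μ f φ z ∂ν = lam * ∫ z, φ z ∂ν) ∧
      (∀ φ : (ℕ → M) → ℝ, Continuous φ →
        TendstoUniformly
          (fun n : ℕ => fun x => (lam ^ n)⁻¹ * ((ruelle μ f)^[n] φ) x)
          (fun x => hfun x * ∫ z, φ z ∂ν) atTop) ∧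
      (∀ ν' : Measure (ℕ → M), IsProbabilityMeasure ν' →
        (∀ φ : (ℕ → M) → ℝ, Continuous φ →
          ∫ z, ruelle μ f φ z ∂ν' = lam * ∫ z, φ z ∂ν') → ν' = ν) := by
  have : μ.IsOpenPosMeasure := ⟨fun U hU hne => (hsupp U hU hne).ne'⟩
  have : SecondCountableTopology M := EMetric.secondCountable_of_sigmaCompact M
  have : Nonempty M := nonempty_of_isProbabilityMeasure μ
  obtain ⟨F, rfl⟩ : ∃ F : C(ℕ → M, ℝ), ⇑F = f := ⟨⟨f, hf⟩, rfl⟩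
  obtain ⟨l, B, hl, hB, hlB⟩ := exists_ruelleCLM_pow_one_comparable μ hWW
  set T : C(ℕ → M, ℝ) →L[ℝ] C(ℕ → M, ℝ) := l⁻¹ • ruelleCLM μ F with hT
  have hTapp : ∀ φ, ruelleCLM μ F φ = l • T φ := fun φ => by
    simp [hT, smul_smul, mul_inv_cancel₀ hl.ne']
  have hTpow : ∀ n φ x, (T ^ n) φ x = (l ^ n)⁻¹ * (ruelleCLM μ F ^ n) φ x := fun n φ x => by
    rw [hT, smul_pow, inv_pow]
    rfl
  obtain ⟨h, ℓ, hh, hfix, hone, hpos, hinv, hlim⟩ := exists_perron_frobenius (T := T)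
    (fun u hu => smul_nonneg (inv_nonneg.2 hl.le) (ruelleCLM_nonneg μ F hu))
    (fun u hu hz => eq_zero_of_forall_exists_ruelleCLM_pow_eq_zero μ F hu fun n => by
      obtain ⟨x, hx⟩ := hz n
      rw [hTpow] at hx
      exact ⟨x, (mul_eq_zero.1 hx).resolve_left (by positivity)⟩) hB
    (fun n x => by
      rw [hTpow, inv_mul_le_iff₀ (by positivity), mul_comm]
      exact (hlB n x).1)
    (fun n x => by
      rw [hTpow, mul_left_comm, le_inv_mul_iff₀ (by positivity), mul_one]
      exact (hlB n x).2)
    (fun v hv r hr x => by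
      filter_upwards [ratioEquicontinuous_ruelleCLM_pow μ hWW hv r hr x] with y hy n
      have hn : 0 ≤ (l ^ n)⁻¹ := by positivity
      rw [hTpow, hTpow, mul_left_comm, mul_left_comm r]
      exact ⟨mul_le_mul_of_nonneg_left (hy n).1 hn, mul_le_mul_of_nonneg_left (hy n).2 hn⟩)
  obtain ⟨ν, hν, hνℓ⟩ := exists_isProbabilityMeasure_forall_integral_eq ℓ hpos hone
  have hTφ : ∀ (φ : C(ℕ → M, ℝ)) x, ruelle μ F φ x = l * T φ x := fun φ x =>
    congrArg (fun g : C(ℕ → M, ℝ) => g x) (hTapp φ)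
  refine ⟨l, hl, h, h.continuous, hh, ν, hν, fun x => ?_, fun φ hφ => ?_, fun φ hφ => ?_,
    fun ν' hν' hν'eig => ?_⟩
  · rw [hTφ, hfix]
  · have h1 : ∀ z, ruelle μ F φ z = l * T ⟨φ, hφ⟩ z := hTφ ⟨φ, hφ⟩
    simp only [h1, integral_const_mul, hνℓ, hinv]
    rw [← hνℓ]
    rfl
  · have h1 := ContinuousMap.tendsto_iff_tendstoUniformly.1 (hlim ⟨φ, hφ⟩)
    have h2 : ∀ n x, (T ^ n) ⟨φ, hφ⟩ x = (l ^ n)⁻¹ * ((ruelle μ F)^[n] φ) x := fun n x => by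
      rw [hTpow, coe_ruelleCLM_pow]
      rfl
    have h3 : ∫ z, φ z ∂ν = ℓ ⟨φ, hφ⟩ := hνℓ ⟨φ, hφ⟩
    simp only [← h2, h3, mul_comm _ (ℓ _)]
    exact h1
  · have hT' : ∀ φ : C(ℕ → M, ℝ), ∫ z, T φ z ∂ν' = ∫ z, φ z ∂ν' := fun φ => by
      have h1 := hν'eig φ φ.continuous
      simp only [hTφ, integral_const_mul] at h1
      exact mul_left_cancel₀ hl.ne' h1
    have hTn : ∀ n (φ : C(ℕ → M, ℝ)), ∫ z, (T ^ n) φ z ∂ν' = ∫ z, φ z ∂ν' := fun n φ => by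
      induction n with
      | zero => rfl
      | succ n ih => rw [pow_succ', mul_apply_eq_comp, hT', ih]
    have hcont : Continuous fun φ : C(ℕ → M, ℝ) => ∫ z, φ z ∂ν' := by
      refine (LipschitzWith.of_dist_le_mul (K := 1) fun φ ψ => ?_).continuous
      have hi : ∀ φ : C(ℕ → M, ℝ), Integrable φ ν' := fun φ =>
        φ.continuous.integrable_of_hasCompactSupport (HasCompactSupport.of_compactSpace _)
      rw [dist_eq_norm, dist_eq_norm, ← integral_sub (hi φ) (hi ψ)]
      simpa using norm_integral_le_of_norm_le_const (μ := ν')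
        (Eventually.of_forall (φ - ψ).norm_coe_le_norm)
    have hrep : ∀ φ : C(ℕ → M, ℝ), ∫ z, φ z ∂ν' = ℓ φ * ∫ z, h z ∂ν' := fun φ => by
      refine tendsto_nhds_unique (tendsto_const_nhds.congr fun n => (hTn n φ).symm)
        (((hcont.tendsto _).comp (hlim φ)).trans_eq ?_)
      simp [integral_const_mul]
    have hh1 : ∫ z, h z ∂ν' = 1 := by simpa [hone] using (hrep 1).symm
    refine ext_of_forall_integral_eq_of_IsFiniteMeasure fun g => ?_
    have := hrep g.toContinuousMap
    rw [hh1, mul_one, ← hνℓ] at this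
    exact this

end Paper
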